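/- Let Ũ be a positive bounded linear operator on the complex space X_ℂ = L^p(E, μ; ℂ) whose restriction to the real subspace is strictly positive, and let φ₀ be a strictly positive continuous linear functional (φ₀(h) > 0 for every a.e.-nonnegative real h ≠ 0) with Ũ* φ₀ = φ₀. Suppose f ∈ X_ℂ \ {0} and α ∈ (0, 2π) satisfy Ũ f = e^{iα} f. Then Ũ |f| = |f|, |f| > 0 a.e., and for every g ∈ X_ℂ one has Ũ(f g / |f|) = e^{iα} (f / |f|) Ũ g. -/

import Mathlib

open MeasureTheory Filter ENNReal


section Helpers
variable {α' : Type*} [MeasurableSpace α'] {μ : Measure α'} {p : ℝ≥0∞} [Fact (1 ≤ p)]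

theorem aux_reim (g : Lp ℂ p μ) : ∃ r i : Lp ℂ p μ, g = r + Complex.I • i ∧
    (∀ᵐ x ∂μ, r x = ((g x).re : ℂ)) ∧ (∀ᵐ x ∂μ, i x = ((g x).im : ℂ)) := by
  have hr : MemLp (fun x => ((g x).re : ℂ)) p μ := by
    refine MemLp.of_le (Lp.memLp g) ?_ (Eventually.of_forall fun x => ?_)
    · exact Complex.continuous_ofReal.comp_aestronglyMeasurable
        (Complex.continuous_re.comp_aestronglyMeasurable (Lp.aestronglyMeasurable g))
    · simpa using Complex.abs_re_le_norm (g x)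
  have hi : MemLp (fun x => ((g x).im : ℂ)) p μ := by
    refine MemLp.of_le (Lp.memLp g) ?_ (Eventually.of_forall fun x => ?_)
    · exact Complex.continuous_ofReal.comp_aestronglyMeasurable
        (Complex.continuous_im.comp_aestronglyMeasurable (Lp.aestronglyMeasurable g))
    · simpa using Complex.abs_im_le_norm (g x)
  refine ⟨hr.toLp _, hi.toLp _, ?_, hr.coeFn_toLp, hi.coeFn_toLp⟩
  apply Lp.ext
  filter_upwards [hr.coeFn_toLp, hi.coeFn_toLp,
    Lp.coeFn_add (hr.toLp _) (Complex.I • hi.toLp _),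
    Lp.coeFn_smul Complex.I (hi.toLp _)] with x h1 h2 h3 h4
  rw [h3, Pi.add_apply, h4, Pi.smul_apply, h1, h2, smul_eq_mul, mul_comm, Complex.re_add_im]

theorem aux_re_le (U : Lp ℂ p μ →L[ℂ] Lp ℂ p μ)
    (hreal : ∀ f : Lp ℂ p μ, (∀ᵐ x ∂μ, (f x).im = 0) → (∀ᵐ x ∂μ, ((U f) x).im = 0))
    (hpos : ∀ f : Lp ℂ p μ, (∀ᵐ x ∂μ, (f x).im = 0 ∧ 0 ≤ (f x).re) →
      (∀ᵐ x ∂μ, ((U f) x).im = 0 ∧ 0 ≤ ((U f) x).re))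
    (g G : Lp ℂ p μ) (h : ∀ᵐ x ∂μ, (G x).im = 0 ∧ (g x).re ≤ (G x).re) :
    ∀ᵐ x ∂μ, (U g x).re ≤ (U G x).re := by
  obtain ⟨r, i, hg, hr, hi⟩ := aux_reim g
  have h1 := hpos (G - r) (by
    filter_upwards [h, hr, Lp.coeFn_sub G r] with x h1 h2 h3
    rw [h3, Pi.sub_apply, h2]
    simpa [h1.1] using h1.2)
  have h2 := hreal i (by filter_upwards [hi] with x h1; simp [h1])
  have h3 : U g = U r + Complex.I • U i := by
    conv_lhs => rw [hg]
    simp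
  rw [map_sub] at h1
  filter_upwards [h1, h2, Lp.coeFn_sub (U G) (U r), Lp.coeFn_add (U r) (Complex.I • U i),
    Lp.coeFn_smul Complex.I (U i)] with x h1 h2 h4 h5 h6
  rw [h3, h5, Pi.add_apply, h6, Pi.smul_apply]
  rw [h4, Pi.sub_apply] at h1
  have := h1.2
  simp [h2] at this ⊢
  exact this

theorem aux_norm_le (U : Lp ℂ p μ →L[ℂ] Lp ℂ p μ)
    (hreal : ∀ f : Lp ℂ p μ, (∀ᵐ x ∂μ, (f x).im = 0) → (∀ᵐ x ∂μ, ((U f) x).im = 0))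
    (hpos : ∀ f : Lp ℂ p μ, (∀ᵐ x ∂μ, (f x).im = 0 ∧ 0 ≤ (f x).re) →
      (∀ᵐ x ∂μ, ((U f) x).im = 0 ∧ 0 ≤ ((U f) x).re))
    (g G : Lp ℂ p μ) (h : ∀ᵐ x ∂μ, (G x).im = 0 ∧ ‖g x‖ ≤ (G x).re) :
    ∀ᵐ x ∂μ, ‖U g x‖ ≤ (U G x).re := by
  have key : ∀ c : ℂ, ∀ᵐ x ∂μ, (c * U g x).re ≤ ‖c‖ * (U G x).re := by
    intro c
    have := aux_re_le U hreal hpos (c • g) ((‖c‖ : ℂ) • G) (by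
      filter_upwards [h, Lp.coeFn_smul c g, Lp.coeFn_smul (‖c‖ : ℂ) G] with x h1 h2 h3
      rw [h2, h3, Pi.smul_apply, Pi.smul_apply, smul_eq_mul, smul_eq_mul]
      refine ⟨by simp [h1.1], ?_⟩
      rw [Complex.re_ofReal_mul]
      calc _ ≤ ‖c * g x‖ := Complex.re_le_norm _
        _ = ‖c‖ * ‖g x‖ := norm_mul _ _
        _ ≤ _ := by gcongr; exact h1.2)
    rw [map_smul, map_smul] at this
    filter_upwards [this, Lp.coeFn_smul c (U g), Lp.coeFn_smul (‖c‖ : ℂ) (U G)] with x h1 h2 h3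
    rw [h2, h3, Pi.smul_apply, Pi.smul_apply, smul_eq_mul, smul_eq_mul,
      Complex.re_ofReal_mul] at h1
    exact h1
  have key2 : ∀ᵐ x ∂μ, ∀ n : ℕ, (TopologicalSpace.denseSeq ℂ n * U g x).re ≤
      ‖TopologicalSpace.denseSeq ℂ n‖ * (U G x).re := ae_all_iff.2 fun n => key _
  have hG := hpos G (by
    filter_upwards [h] with x h1
    exact ⟨h1.1, (norm_nonneg _).trans h1.2⟩)
  filter_upwards [key2, hG] with x hx hGx
  have hcl : IsClosed {c : ℂ | (c * U g x).re ≤ ‖c‖ * (U G x).re} :=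
    isClosed_le (by fun_prop) (by fun_prop)
  have hall : ∀ c : ℂ, (c * U g x).re ≤ ‖c‖ * (U G x).re := by
    intro c
    have : closure (Set.range (TopologicalSpace.denseSeq ℂ)) ⊆
        {c : ℂ | (c * U g x).re ≤ ‖c‖ * (U G x).re} := by
      apply closure_minimal _ hcl
      rintro _ ⟨n, rfl⟩
      exact hx n
    rw [(TopologicalSpace.denseRange_denseSeq ℂ).closure_range] at this
    exact this (Set.mem_univ c)
  have h1 := hall ((starRingEnd ℂ) (U g x))
  rw [mul_comm, Complex.mul_conj, RCLike.norm_conj, Complex.ofReal_re,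
    Complex.normSq_eq_norm_sq] at h1
  rcases (norm_nonneg (U g x)).eq_or_lt with h0 | h0
  · rw [← h0]; exact hGx.2
  · rw [sq] at h1
    exact le_of_mul_le_mul_left h1 h0

theorem aux_mul (s : α' → ℂ) (hs : AEStronglyMeasurable s μ) (hb : ∀ x, ‖s x‖ ≤ 1) :
    ∃ M : Lp ℂ p μ →L[ℂ] Lp ℂ p μ, ∀ g, ∀ᵐ x ∂μ, M g x = s x * g x := by
  have hm : ∀ g : Lp ℂ p μ, MemLp (fun x => s x * g x) p μ := fun g => by
    refine MemLp.of_le (Lp.memLp g) (hs.mul (Lp.aestronglyMeasurable g))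
      (Eventually.of_forall fun x => ?_)
    rw [norm_mul]
    exact mul_le_of_le_one_left (norm_nonneg _) (hb x)
  let L : Lp ℂ p μ →ₗ[ℂ] Lp ℂ p μ :=
    { toFun := fun g => (hm g).toLp _
      map_add' := fun g h => by
        apply Lp.ext
        filter_upwards [(hm g).coeFn_toLp, (hm h).coeFn_toLp, (hm (g + h)).coeFn_toLp,
          Lp.coeFn_add g h, Lp.coeFn_add ((hm g).toLp _) ((hm h).toLp _)] with x h1 h2 h3 h4 h5
        rw [h3, h5, Pi.add_apply, h1, h2, h4, Pi.add_apply, mul_add]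
      map_smul' := fun c g => by
        apply Lp.ext
        filter_upwards [(hm g).coeFn_toLp, (hm (c • g)).coeFn_toLp,
          Lp.coeFn_smul c g, Lp.coeFn_smul c ((hm g).toLp _)] with x h1 h3 h4 h5
        rw [h3, RingHom.id_apply, h5, Pi.smul_apply, h1, h4, Pi.smul_apply, smul_eq_mul,
          smul_eq_mul, mul_left_comm] }
  refine ⟨L.mkContinuous 1 fun g => ?_, fun g => (hm g).coeFn_toLp⟩
  rw [one_mul]
  apply Lp.norm_le_norm_of_ae_le
  filter_upwards [(hm g).coeFn_toLp] with x h1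
  change ‖(hm g).toLp _ x‖ ≤ _
  rw [h1, norm_mul]
  exact mul_le_of_le_one_left (norm_nonneg _) (hb x)

theorem aux_trunc (hp : p ≠ ∞) (f g : Lp ℂ p μ) (hf : ∀ᵐ x ∂μ, 0 < ‖f x‖) :
    ∃ G : ℕ → Lp ℂ p μ, Tendsto G atTop (nhds g) ∧
      ∀ n, ∀ᵐ x ∂μ, ‖G n x‖ ≤ n * ‖f x‖ ∧ (G n x = g x ∨ G n x = 0) := by
  have hp0 : p ≠ 0 := (zero_lt_one.trans_le (Fact.out : 1 ≤ p)).ne'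
  have hppos : 0 < p.toReal := ENNReal.toReal_pos hp0 hp
  let S : ℕ → Set α' := fun n => {x | ‖g x‖ ≤ n * ‖f x‖}
  have hS : ∀ n, MeasurableSet (S n) := fun n =>
    measurableSet_le (Lp.stronglyMeasurable g).norm.measurable
      ((Lp.stronglyMeasurable f).norm.measurable.const_mul _)
  have hm : ∀ n, MemLp ((S n).indicator g) p μ := fun n => (Lp.memLp g).indicator (hS n)
  refine ⟨fun n => (hm n).toLp _, ?_, fun n => ?_⟩
  · rw [Lp.tendsto_Lp_iff_tendsto_eLpNorm']
    have e : ∀ n, eLpNorm (⇑((hm n).toLp _) - ⇑g) p μ =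
        (∫⁻ x, ‖(S n).indicator g x - g x‖ₑ ^ p.toReal ∂μ) ^ (1 / p.toReal) := by
      intro n
      rw [← eLpNorm_eq_lintegral_rpow_enorm_toReal hp0 hp]
      apply eLpNorm_congr_ae
      filter_upwards [(hm n).coeFn_toLp] with x hx
      simp [hx]
    simp_rw [e]
    have hlim : Tendsto (fun n => ∫⁻ x, ‖(S n).indicator g x - g x‖ₑ ^ p.toReal ∂μ) atTop
        (nhds (∫⁻ x, 0 ∂μ)) := by
      refine tendsto_lintegral_of_dominated_convergence' (fun x => ‖g x‖ₑ ^ p.toReal) ?_ ?_ ?_ ?_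
      · intro n
        exact (((hm n).1.sub (Lp.aestronglyMeasurable g)).enorm.pow_const _)
      · intro n
        refine Eventually.of_forall fun x => ?_
        apply ENNReal.rpow_le_rpow _ hppos.le
        by_cases hx : x ∈ S n <;> simp [hx]
      · exact (lintegral_rpow_enorm_lt_top_of_eLpNorm_lt_top hp0 hp (Lp.memLp g).2).ne
      · filter_upwards [hf] with x hx
        apply tendsto_const_nhds.congr'
        obtain ⟨N, hN⟩ := exists_nat_ge (‖g x‖ / ‖f x‖)
        filter_upwards [eventually_ge_atTop N] with n hn
        have : x ∈ S n := by
          change ‖g x‖ ≤ n * ‖f x‖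
          rw [← div_le_iff₀ hx]
          exact hN.trans (by exact_mod_cast hn)
        simp [this, hppos]
    have := hlim.ennrpow_const (1 / p.toReal)
    simpa [hppos] using this
  · filter_upwards [(hm n).coeFn_toLp] with x hx
    rw [hx]
    by_cases hxs : x ∈ S n
    · rw [Set.indicator_of_mem hxs]
      exact ⟨hxs, Or.inl rfl⟩
    · simp only [Set.indicator_of_notMem hxs, norm_zero, or_true, and_true]
      positivity

theorem aux_cx (w : ℂ) (k u : ℝ) (h1 : ‖(k : ℂ) - w‖ ≤ k - u) (h2 : ‖(k : ℂ) + w‖ ≤ k + u) :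
    w = u := by
  have a1 := (Complex.re_le_norm _).trans h1
  have a2 := (Complex.re_le_norm _).trans h2
  simp at a1 a2
  have hu : w.re = u := by linarith
  have b1 : ‖(k : ℂ) - w‖ ^ 2 ≤ (k - u) ^ 2 := by gcongr
  rw [← Complex.normSq_eq_norm_sq, Complex.normSq_apply] at b1
  simp [hu] at b1
  have : w.im = 0 := by nlinarith
  apply Complex.ext <;> simp [hu, this]

end Helpers

/-- **Step 1 of the proof of Theorem 2.2 iii).**  Let `Ũ` be a positive bounded operator on
`X_ℂ = L^p(E, μ; ℂ)` whose restriction to the real subspace is strictly positive, and let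
`φ₀` be a strictly positive continuous linear functional with `Ũ* φ₀ = φ₀`.  If `f ≠ 0`
and `α ∈ (0, 2π)` satisfy `Ũ f = e^{iα} f`, then `Ũ |f| = |f|`, `|f| > 0` a.e., and for
every `g` one has `Ũ (f g / |f|) = e^{iα} (f / |f|) Ũ g` (a.e.). -/
theorem rotation_eigenfunction_transfer
    {α' : Type*} [MeasurableSpace α'] {μ : Measure α'} [SigmaFinite μ]
    {p : ℝ≥0∞} [Fact (1 ≤ p)] (hp : p ≠ ∞)
    (U : Lp ℂ p μ →L[ℂ] Lp ℂ p μ)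
    (hreal : ∀ f : Lp ℂ p μ, (∀ᵐ x ∂μ, (f x).im = 0) → (∀ᵐ x ∂μ, ((U f) x).im = 0))
    (hpos : ∀ f : Lp ℂ p μ, (∀ᵐ x ∂μ, (f x).im = 0 ∧ 0 ≤ (f x).re) →
      (∀ᵐ x ∂μ, ((U f) x).im = 0 ∧ 0 ≤ ((U f) x).re))
    (hstrict : ∀ f : Lp ℂ p μ, (∀ᵐ x ∂μ, (f x).im = 0 ∧ 0 ≤ (f x).re) → f ≠ 0 →
      (∀ᵐ x ∂μ, ((U f) x).im = 0 ∧ 0 < ((U f) x).re))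
    (φ₀ : Lp ℂ p μ →L[ℂ] ℂ)
    (hφ₀strict : ∀ h : Lp ℂ p μ, (∀ᵐ x ∂μ, (h x).im = 0 ∧ 0 ≤ (h x).re) → h ≠ 0 →
      (φ₀ h).im = 0 ∧ 0 < (φ₀ h).re)
    (hφ₀ : ∀ f, φ₀ (U f) = φ₀ f)
    (f : Lp ℂ p μ) (hf : f ≠ 0) (a : ℝ) (ha0 : 0 < a) (ha2π : a < 2 * Real.pi)
    (hfeig : U f = Complex.exp (a * Complex.I) • f) :
    (∀ᵐ x ∂μ, 0 < ‖f x‖) ∧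
    (∀ fa : Lp ℂ p μ, (∀ᵐ x ∂μ, fa x = (‖f x‖ : ℂ)) → U fa = fa) ∧
    (∀ g h : Lp ℂ p μ, (∀ᵐ x ∂μ, h x = f x * g x / (‖f x‖ : ℂ)) →
      ∀ᵐ x ∂μ, (U h) x = Complex.exp (a * Complex.I) * (f x / (‖f x‖ : ℂ)) * (U g) x) := by
  have hem : AEStronglyMeasurable (fun x => f x) μ := Lp.aestronglyMeasurable f
  have hFm : MemLp (fun x => (‖f x‖ : ℂ)) p μ := by
    refine MemLp.of_le (Lp.memLp f)
      (Complex.continuous_ofReal.comp_aestronglyMeasurable hem.norm)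
      (Eventually.of_forall fun x => by simp)
  set e : ℂ := Complex.exp (a * Complex.I) with he
  have hen : ‖e‖ = 1 := Complex.norm_exp_ofReal_mul_I a
  obtain ⟨F, hF⟩ : ∃ F : Lp ℂ p μ, ∀ᵐ x ∂μ, F x = (‖f x‖ : ℂ) := ⟨hFm.toLp _, hFm.coeFn_toLp⟩
  have hUfx : ∀ᵐ x ∂μ, U f x = e * f x := by
    rw [hfeig]
    exact Lp.coeFn_smul e f
  have hFpos : ∀ᵐ x ∂μ, (F x).im = 0 ∧ 0 ≤ (F x).re := by
    filter_upwards [hF] with x hx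
    simp [hx]
  have hle := aux_norm_le U hreal hpos f F (by
    filter_upwards [hF] with x hx
    simp [hx])
  have hUF : U F = F := by
    by_contra hne
    have := hφ₀strict (U F - F) (by
      filter_upwards [hle, hF, hUfx, hpos F hFpos, Lp.coeFn_sub (U F) F] with x h1 h2 h3 h4 h5
      rw [h5, Pi.sub_apply, h2]
      rw [h3, norm_mul, hen, one_mul] at h1
      simpa [h4.1] using h1) (sub_ne_zero.2 hne)
    rw [map_sub, hφ₀, sub_self] at this
    simp at this
  have hF0 : F ≠ 0 := by
    rintro rfl
    apply hf
    apply Lp.ext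
    filter_upwards [hF, Lp.coeFn_zero ℂ p μ] with x h1 h2
    rw [h2] at h1 ⊢
    simpa using h1.symm
  have hfpos : ∀ᵐ x ∂μ, 0 < ‖f x‖ := by
    have := hstrict F hFpos hF0
    rw [hUF] at this
    filter_upwards [this, hF] with x h1 h2
    simpa [h2] using h1.2
  refine ⟨hfpos, ?_, ?_⟩
  · intro fa hfa
    have : fa = F := by
      apply Lp.ext
      filter_upwards [hfa, hF] with x h1 h2
      rw [h1, h2]
    rw [this, hUF]
  obtain ⟨M, hM⟩ := aux_mul (p := p) (μ := μ) (fun x => f x / (‖f x‖ : ℂ))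
    (by
      have h1 : Measurable fun x => f x := (Lp.stronglyMeasurable f).measurable
      exact (h1.div (Complex.measurable_ofReal.comp h1.norm)).aestronglyMeasurable)
    (fun x => by
      rw [norm_div, Complex.norm_real, norm_norm]
      exact div_self_le_one _)
  have hMF : M F = f := by
    apply Lp.ext
    filter_upwards [hM F, hF, hfpos] with x h1 h2 h3
    rw [h1, h2]
    exact div_mul_cancel₀ _ (by exact_mod_cast h3.ne')
  have hMn : ∀ g : Lp ℂ p μ, ∀ᵐ x ∂μ, ‖M g x‖ ≤ ‖g x‖ := by
    intro g
    filter_upwards [hM g] with x h1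
    rw [h1, norm_mul, norm_div, Complex.norm_real, norm_norm]
    exact mul_le_of_le_one_left (norm_nonneg _) (div_self_le_one _)
  have main1 : ∀ (g : Lp ℂ p μ) (k : ℝ),
      (∀ᵐ x ∂μ, (g x).im = 0 ∧ ‖g x‖ ≤ k * ‖f x‖) → U (M g) = e • M (U g) := by
    intro g k hg
    have half : ∀ g : Lp ℂ p μ, (∀ᵐ x ∂μ, (g x).im = 0 ∧ ‖g x‖ ≤ k * ‖f x‖) →
        ∀ᵐ x ∂μ, ‖(k : ℂ) * (e * f x) - U (M g) x‖ ≤ k * ‖f x‖ - (U g x).re := by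
      intro g hg
      have h1 := aux_norm_le U hreal hpos (M ((k : ℂ) • F - g)) ((k : ℂ) • F - g) (by
        filter_upwards [hMn ((k : ℂ) • F - g), Lp.coeFn_sub ((k : ℂ) • F) g,
          Lp.coeFn_smul (k : ℂ) F, hF, hg] with x h1 h2 h3 h4 h5
        have h6 : ((k : ℂ) • F - g : Lp ℂ p μ) x = ((k * ‖f x‖ - (g x).re : ℝ) : ℂ) := by
          rw [h2, Pi.sub_apply, h3, Pi.smul_apply, h4]
          apply Complex.ext <;> simp [h5.1]
        rw [h6] at h1 ⊢
        refine ⟨Complex.ofReal_im _, h1.trans ?_⟩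
        rw [Complex.norm_real, Complex.ofReal_re, Real.norm_eq_abs, abs_of_nonneg]
        exact sub_nonneg.2 ((Complex.re_le_norm _).trans h5.2))
      rw [map_sub, map_smul, hMF, map_sub, map_smul, hfeig, map_sub, map_smul, hUF] at h1
      filter_upwards [h1, Lp.coeFn_sub ((k : ℂ) • e • f) (U (M g)),
        Lp.coeFn_smul (k : ℂ) (e • f), Lp.coeFn_smul e f, Lp.coeFn_sub ((k : ℂ) • F) (U g),
        Lp.coeFn_smul (k : ℂ) F, hF] with x h1 h2 h3 h4 h5 h6 h7
      rw [h2, Pi.sub_apply, h3, Pi.smul_apply, h4, Pi.smul_apply, h5, Pi.sub_apply, h6,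
        Pi.smul_apply, h7] at h1
      simpa using h1
    have hn := half (-g) (by
      filter_upwards [hg, Lp.coeFn_neg g] with x h1 h2
      rw [h2]
      simpa using h1)
    rw [map_neg, map_neg, map_neg] at hn
    apply Lp.ext
    filter_upwards [half g hg, hn, Lp.coeFn_neg (U (M g)), Lp.coeFn_neg (U g), hfpos,
      Lp.coeFn_smul e (M (U g)), hM (U g),
      hreal g (hg.mono fun x h => h.1)] with x h1 h2 h3 h4 h5 h6 h7 h8
    rw [h3, h4, Pi.neg_apply, Pi.neg_apply] at h2
    rw [h6, Pi.smul_apply, h7, smul_eq_mul]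
    have hr0 : (‖f x‖ : ℂ) ≠ 0 := by exact_mod_cast h5.ne'
    have hf0 : f x ≠ 0 := norm_pos_iff.1 h5
    have he0 : e ≠ 0 := Complex.exp_ne_zero _
    set t : ℂ := e * (f x / (‖f x‖ : ℂ)) with ht
    have htn : ‖t‖ = 1 := by
      rw [ht, norm_mul, hen, norm_div, Complex.norm_real, norm_norm, div_self h5.ne', mul_one]
    have ht0 : t ≠ 0 := mul_ne_zero he0 (div_ne_zero hf0 hr0)
    have hef : (k : ℂ) * (e * f x) = t * ((k * ‖f x‖ : ℝ) : ℂ) := by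
      rw [ht]; push_cast; field_simp
    obtain ⟨w, hw⟩ : ∃ w, U (M g) x = t * w := ⟨U (M g) x / t, by field_simp⟩
    rw [hef, hw, ← mul_sub, norm_mul, htn, one_mul] at h1
    rw [hef, hw, sub_neg_eq_add, ← mul_add, norm_mul, htn, one_mul, Complex.neg_re,
      sub_neg_eq_add] at h2
    rw [hw, aux_cx w _ _ h1 h2, ← mul_assoc, ← ht]
    congr 1
    apply Complex.ext <;> simp [h8]
  have main2 : ∀ g : Lp ℂ p μ, (∀ᵐ x ∂μ, (g x).im = 0) → U (M g) = e • M (U g) := by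
    intro g hg
    obtain ⟨G, hG, hGn⟩ := aux_trunc hp f g hfpos
    have h1 : ∀ n, U (M (G n)) = e • M (U (G n)) := fun n => main1 (G n) n (by
      filter_upwards [hGn n, hg] with x h1 h2
      refine ⟨?_, h1.1⟩
      rcases h1.2 with h | h <;> simp [h, h2])
    have c1 : Tendsto (fun n => U (M (G n))) atTop (nhds (U (M g))) :=
      ((U.continuous.comp M.continuous).tendsto g).comp hG
    have c2 : Tendsto (fun n => e • M (U (G n))) atTop (nhds (e • M (U g))) :=
      (((M.continuous.comp U.continuous).tendsto g).comp hG).const_smul e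
    simp_rw [h1] at c1
    exact tendsto_nhds_unique c1 c2
  have main3 : ∀ g : Lp ℂ p μ, U (M g) = e • M (U g) := by
    intro g
    obtain ⟨r, i, hg, hr, hi⟩ := aux_reim g
    have h1 := main2 r (by filter_upwards [hr] with x hx; simp [hx])
    have h2 := main2 i (by filter_upwards [hi] with x hx; simp [hx])
    rw [hg]
    simp only [map_add, map_smul, h1, h2, smul_add]
    rw [smul_comm]
  intro g h hh
  have : h = M g := by
    apply Lp.ext
    filter_upwards [hh, hM g] with x h1 h2
    rw [h1, h2]
    ring
  rw [this, main3 g]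
  filter_upwards [Lp.coeFn_smul e (M (U g)), hM (U g)] with x h1 h2
  rw [h1, Pi.smul_apply, h2, smul_eq_mul, mul_assoc]
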